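/- arXiv:1910.08843 — 2 statements merged into one kernel-verified Lean document; each statement's English description precedes it below -/
import Mathlib

section
/- For every integer n ≥ 4 and every integer r with 3 ≤ r ≤ n−1, the symmetric group S_n has at least one string C-group representation of rank r; in particular, the set of ranks of string C-group representations of S_n is the full interval {3, …, n−1}. -/
/-- A string C-group representation of rank `n` of a group `G`: a family of `n`
involutions generating `G`, satisfying the commuting (string) property and the
intersection property. -/
def IsStringCGroupRep {G : Type*} [Group G] {n : ℕ} (ρ : Fin n → G) : Prop :=
  (∀ i, orderOf (ρ i) = 2) ∧
  Subgroup.closure (Set.range ρ) = ⊤ ∧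
  (∀ i j : Fin n, i.val + 1 < j.val → Commute (ρ i) (ρ j)) ∧
  (∀ I J : Set (Fin n),
    Subgroup.closure (ρ '' I) ⊓ Subgroup.closure (ρ '' J) = Subgroup.closure (ρ '' (I ∩ J)))

open Equiv

/-- A family of involutions satisfies the intersection property as soon as every subgroup
`closure (ρ '' I)` is cut out by subgroups `P i`, `i ∉ I`, where `P i` contains every generator
other than `ρ i`. -/
theorem closure_inf_closure_of_separating {G ι : Type*} [Group G] {ρ : ι → G}
    (P : ι → Subgroup G) (hP : ∀ i l, l ≠ i → ρ l ∈ P i)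
    (hI : ∀ (I : Set ι) (g : G), (∀ i, i ∉ I → g ∈ P i) → g ∈ Subgroup.closure (ρ '' I))
    (I J : Set ι) :
    Subgroup.closure (ρ '' I) ⊓ Subgroup.closure (ρ '' J) = Subgroup.closure (ρ '' (I ∩ J)) := by
  have hle : ∀ (K : Set ι) (i : ι), i ∉ K → Subgroup.closure (ρ '' K) ≤ P i := by
    intro K i hi
    rw [Subgroup.closure_le]
    rintro _ ⟨l, hl, rfl⟩
    exact hP i l fun h => hi (h ▸ hl)
  refine le_antisymm ?_ ?_
  · rintro g ⟨hgI, hgJ⟩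
    refine hI _ g fun i hi => ?_
    by_cases h : i ∈ I
    · exact hle J i (fun h' => hi ⟨h, h'⟩) hgJ
    · exact hle I i h hgI
  · exact le_inf (Subgroup.closure_mono (Set.image_mono Set.inter_subset_left))
      (Subgroup.closure_mono (Set.image_mono Set.inter_subset_right))

/-- String C-group representations are transported by group isomorphisms. -/
theorem IsStringCGroupRep.map {G H : Type*} [Group G] [Group H] {n : ℕ} {ρ : Fin n → G}
    (h : IsStringCGroupRep ρ) (e : G ≃* H) : IsStringCGroupRep (fun i => e (ρ i)) := by
  obtain ⟨h1, h2, h3, h4⟩ := h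
  have hcl : ∀ I : Set (Fin n), Subgroup.closure ((fun i => e (ρ i)) '' I) =
      (Subgroup.closure (ρ '' I)).map e.toMonoidHom := by
    intro I
    rw [MonoidHom.map_closure, Set.image_image]
    rfl
  refine ⟨fun i => ?_, ?_, fun i j hij => (h3 i j hij).map e, fun I J => ?_⟩
  · rw [← h1 i]
    exact orderOf_injective e.toMonoidHom e.injective (ρ i)
  · rw [← Set.image_univ, hcl, Set.image_univ, h2]
    exact Subgroup.map_top_of_surjective _ e.surjective
  · rw [hcl, hcl, hcl, ← h4, Subgroup.map_inf _ _ _ e.injective]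

section Swaps

variable {α : Type*} [DecidableEq α] {G : Subgroup (Perm α)}

theorem swap_apply_mem {g : Perm α} {a b : α} (hg : g ∈ G) (h : swap a b ∈ G) :
    swap (g a) (g b) ∈ G := by
  rw [swap_apply_apply]
  exact G.mul_mem (G.mul_mem hg h) (G.inv_mem hg)

/-- A permutation lies in `G` if `G` contains the transpositions `(a, g a)`. -/
theorem mem_of_swap_apply_mem [Finite α] {g : Perm α} (h : ∀ a, swap a (g a) ∈ G) : g ∈ G := by
  let S : Set (Perm α) := {f | f.IsSwap ∧ f ∈ G}
  have hS : Subgroup.closure S ≤ G := by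
    rw [Subgroup.closure_le]
    exact fun f hf => hf.2
  refine hS ((mem_closure_isSwap fun f hf => hf.1).2 ⟨Set.toFinite _, fun a => ?_⟩)
  by_cases ha : g a = a
  · rw [ha]
    exact MulAction.mem_orbit_self a
  · exact ⟨⟨swap a (g a), Subgroup.subset_closure ⟨⟨a, g a, Ne.symm ha, rfl⟩, h a⟩⟩,
      swap_apply_left a (g a)⟩

end Swaps

namespace CycleWithTail

/-- A `k`-cycle of points, to which a path of `m + 1` further points is attached. -/
abbrev Point (k m : ℕ) := ZMod k ⊕ Fin (m + 1)

variable {k m : ℕ}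

/-- The path that starts at the point `0` of the cycle and runs along the tail. -/
def path : Fin (m + 2) → Point k m := Fin.cons (Sum.inl 0) Sum.inr

/-- The distance of a point from the cycle. -/
def level : Point k m → Fin (m + 2) := Sum.elim (fun _ => 0) Fin.succ

/-- The reflection `x ↦ c - x` of the cycle, fixing the tail. -/
def refl (c : ZMod k) : Perm (Point k m) := sumCongr (Equiv.subLeft c) 1

/-- The transposition of two consecutive points of the path. -/
def step (j : Fin (m + 1)) : Perm (Point k m) := swap (path j.castSucc) (path j.succ)

/-- Two reflections of the cycle, followed by the transpositions along the tail. -/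
def gen : Fin (m + 3) → Perm (Point k m) := Fin.cons (refl 0) (Fin.cons (refl 1) step)

@[simp] theorem refl_inl (c x : ZMod k) : refl (m := m) c (Sum.inl x) = Sum.inl (c - x) := rfl
@[simp] theorem refl_inr (c : ZMod k) (i : Fin (m + 1)) : refl c (Sum.inr i) = Sum.inr i := rfl
@[simp] theorem level_inl (x : ZMod k) : level (m := m) (Sum.inl x) = 0 := rfl
@[simp] theorem level_inr (i : Fin (m + 1)) : level (k := k) (Sum.inr i) = i.succ := rfl
@[simp] theorem path_zero : path (k := k) (m := m) 0 = Sum.inl 0 := rfl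
@[simp] theorem path_succ (i : Fin (m + 1)) : path (k := k) i.succ = Sum.inr i := rfl
@[simp] theorem gen_zero : gen (k := k) (m := m) 0 = refl 0 := rfl
@[simp] theorem gen_one : gen (k := k) (m := m) 1 = refl 1 := rfl
@[simp] theorem gen_succ_succ (j : Fin (m + 1)) : gen (k := k) j.succ.succ = step j := rfl

@[simp] theorem level_path (i : Fin (m + 2)) : level (path (k := k) i) = i := by
  induction i using Fin.cases <;> rfl

theorem path_injective : Function.Injective (path (k := k) (m := m)) :=
  Function.LeftInverse.injective level_path

@[simp] theorem level_refl (c : ZMod k) (a : Point k m) : level (refl c a) = level a := by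
  rcases a with x | i <;> rfl

@[simp] theorem refl_mul_refl_self (c : ZMod k) : refl (m := m) c * refl c = 1 := by
  ext a
  rcases a with x | i <;> simp

theorem step_apply_inl_of_ne (j : Fin (m + 1)) {x : ZMod k} (hx : x ≠ 0) :
    step j (Sum.inl x) = Sum.inl x := by
  refine swap_apply_of_ne_of_ne ?_ (by simp)
  induction j using Fin.cases <;> simp [hx]

theorem step_apply_inl {j : Fin (m + 1)} (hj : j ≠ 0) (x : ZMod k) :
    step j (Sum.inl x) = Sum.inl x := by
  obtain ⟨i, rfl⟩ := Fin.exists_succ_eq.2 hj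
  exact swap_apply_of_ne_of_ne (by simp) (by simp)

/-- The permutations preserving the set of points at level at most `j`. -/
def levelSubgroup (j : Fin (m + 1)) : Subgroup (Perm (Point k m)) where
  carrier := {g | ∀ a, level (g a) ≤ j.castSucc ↔ level a ≤ j.castSucc}
  one_mem' := fun _ => Iff.rfl
  mul_mem' := fun {g h} hg hh a => (hg (h a)).trans (hh a)
  inv_mem' := fun {g} hg a => by simpa using (hg (g⁻¹ a)).symm

/-- The permutations acting on the cycle as an element of the dihedral group. -/
def dihedral (k m : ℕ) : Subgroup (Perm (Point k m)) where
  carrier := {g | ∃ c, (∀ x, g (Sum.inl x) = Sum.inl (c + x)) ∨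
    ∀ x, g (Sum.inl x) = Sum.inl (c - x)}
  one_mem' := ⟨0, Or.inl fun x => by simp⟩
  mul_mem' := by
    rintro g h ⟨c, hg | hg⟩ ⟨d, hh | hh⟩
    · exact ⟨c + d, Or.inl fun x => by simp [hg, hh, add_assoc]⟩
    · exact ⟨c + d, Or.inr fun x => by simp [hg, hh, add_sub_assoc]⟩
    · exact ⟨c - d, Or.inr fun x => by simp [hg, hh, sub_sub]⟩
    · exact ⟨c - d, Or.inl fun x => by simp [hg, hh, sub_add]⟩
  inv_mem' := by
    rintro g ⟨c, hg | hg⟩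
    · exact ⟨-c, Or.inl fun x => by rw [Perm.inv_eq_iff_eq, hg]; simp⟩
    · exact ⟨c, Or.inr fun x => by rw [Perm.inv_eq_iff_eq, hg]; simp⟩

/-- The permutations that act as the identity or as `refl c` on the points of the cycle other than
`0` and `c`. -/
def almostReflection (m : ℕ) (c : ZMod k) : Subgroup (Perm (Point k m)) where
  carrier := {g | (∀ x, x ≠ 0 → x ≠ c → g (Sum.inl x) = Sum.inl x) ∨
    ∀ x, x ≠ 0 → x ≠ c → g (Sum.inl x) = Sum.inl (c - x)}
  one_mem' := Or.inl fun _ _ _ => rfl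
  mul_mem' := by
    have key : ∀ x : ZMod k, x ≠ 0 → x ≠ c → c - x ≠ 0 ∧ c - x ≠ c := fun x h0 hc =>
      ⟨sub_ne_zero.2 hc.symm, fun h => h0 (by simpa using h)⟩
    rintro g h (hg | hg) (hh | hh)
    · exact Or.inl fun x h0 hc => by simp [hh x h0 hc, hg x h0 hc]
    · exact Or.inr fun x h0 hc => by
        simp [hh x h0 hc, hg _ (key x h0 hc).1 (key x h0 hc).2]
    · exact Or.inr fun x h0 hc => by simp [hh x h0 hc, hg x h0 hc]
    · exact Or.inl fun x h0 hc => by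
        simp [hh x h0 hc, hg _ (key x h0 hc).1 (key x h0 hc).2]
  inv_mem' := by
    rintro g (hg | hg)
    · exact Or.inl fun x h0 hc => by rw [Perm.inv_eq_iff_eq, hg x h0 hc]
    · refine Or.inr fun x h0 hc => ?_
      rw [Perm.inv_eq_iff_eq, hg _ (sub_ne_zero.2 hc.symm) fun h => h0 (by simpa using h)]
      simp

theorem refl_mem_levelSubgroup (c : ZMod k) (j : Fin (m + 1)) : refl c ∈ levelSubgroup j :=
  fun a => by simp

theorem step_mem_levelSubgroup {i j : Fin (m + 1)} (h : i ≠ j) :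
    step (k := k) i ∈ levelSubgroup j := by
  intro a
  have hij : i.succ ≤ j.castSucc ↔ i.castSucc ≤ j.castSucc := by
    simp only [Fin.le_def, Fin.val_succ, Fin.val_castSucc]
    omega
  unfold step
  by_cases h1 : a = path i.castSucc
  · simp [h1, hij]
  by_cases h2 : a = path i.succ
  · simp [h2, hij]
  rw [swap_apply_of_ne_of_ne h1 h2]

theorem refl_mem_dihedral (c : ZMod k) : refl c ∈ dihedral k m := ⟨c, Or.inr fun _ => rfl⟩

theorem step_mem_dihedral {j : Fin (m + 1)} (hj : j ≠ 0) : step j ∈ dihedral k m :=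
  ⟨0, Or.inl fun x => by rw [step_apply_inl hj, zero_add]⟩

theorem refl_mem_almostReflection (c : ZMod k) : refl c ∈ almostReflection m c :=
  Or.inr fun _ _ _ => rfl

theorem step_mem_almostReflection (c : ZMod k) (j : Fin (m + 1)) :
    step j ∈ almostReflection m c :=
  Or.inl fun _ hx _ => step_apply_inl_of_ne j hx

/-- A subgroup containing all `gen l` with `l ≠ i`. -/
def maximalParabolic : Fin (m + 3) → Subgroup (Perm (Point k m)) :=
  Fin.cons (almostReflection m 1) (Fin.cons (almostReflection m 0)
    fun j => levelSubgroup j ⊓ ⨅ _ : j = 0, dihedral k m)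

theorem gen_mem_maximalParabolic (i l : Fin (m + 3)) (h : l ≠ i) :
    gen (k := k) l ∈ maximalParabolic i := by
  have hstep : ∀ i j : Fin (m + 1), i ≠ j →
      step i ∈ levelSubgroup j ⊓ ⨅ _ : j = 0, dihedral k m := fun i j hij =>
    ⟨step_mem_levelSubgroup hij, Subgroup.mem_iInf.2 fun hj => step_mem_dihedral (hj ▸ hij)⟩
  have hrefl : ∀ (c : ZMod k) (j : Fin (m + 1)),
      refl c ∈ levelSubgroup j ⊓ ⨅ _ : j = 0, dihedral k m := fun c j =>
    ⟨refl_mem_levelSubgroup c j, Subgroup.mem_iInf.2 fun _ => refl_mem_dihedral c⟩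
  induction i using Fin.cases with
  | zero =>
    induction l using Fin.cases with
    | zero => exact absurd rfl h
    | succ l =>
      induction l using Fin.cases with
      | zero => exact refl_mem_almostReflection 1
      | succ l => exact step_mem_almostReflection 1 l
  | succ i =>
    induction i using Fin.cases with
    | zero =>
      induction l using Fin.cases with
      | zero => exact refl_mem_almostReflection 0
      | succ l =>
        induction l using Fin.cases with
        | zero => exact absurd rfl h
        | succ l => exact step_mem_almostReflection 0 l
    | succ i =>
      induction l using Fin.cases with
      | zero => exact hrefl 0 i
      | succ l =>
        induction l using Fin.cases with
        | zero => exact hrefl 1 i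
        | succ l => exact hstep l i fun hli => h (by rw [hli])

section Membership

variable {G : Subgroup (Perm (Point k m))} {g : Perm (Point k m)}

theorem swap_path_mem (u v : Fin (m + 2)) (huv : u ≤ v)
    (h : ∀ j : Fin (m + 1), u ≤ j.castSucc → j.castSucc < v → step j ∈ G) :
    swap (path u) (path v) ∈ G := by
  induction v using Fin.induction with
  | zero =>
    rw [Fin.le_zero_iff.1 huv, swap_self]
    exact G.one_mem
  | succ v ih =>
    rcases huv.eq_or_lt with rfl | hlt
    · rw [swap_self]
      exact G.one_mem
    · have hle : u ≤ v.castSucc := Fin.le_castSucc_iff.2 hlt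
      exact SubmonoidClass.swap_mem_trans G
        (ih hle fun j h1 h2 => h j h1 (h2.trans Fin.castSucc_lt_succ))
        (h v hle Fin.castSucc_lt_succ)

theorem swap_path_level_mem (hg : ∀ j, step j ∉ G → g ∈ levelSubgroup j) (a : Point k m) :
    swap (path (level a)) (path (level (g a))) ∈ G := by
  rcases le_total (level a) (level (g a)) with h | h
  · refine swap_path_mem _ _ h fun j h1 h2 => ?_
    by_contra hj
    exact h2.not_ge ((hg j hj a).2 h1)
  · rw [swap_comm]
    refine swap_path_mem _ _ h fun j h1 h2 => ?_
    by_contra hj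
    exact h2.not_ge ((hg j hj a).1 h1)

variable [NeZero k]

theorem mem_of_levelSubgroup (hg : ∀ j, step j ∉ G → g ∈ levelSubgroup j)
    (h : ∀ a, g a ≠ a → swap a (path (level a)) ∈ G) : g ∈ G := by
  refine mem_of_swap_apply_mem fun a => ?_
  by_cases ha : g a = a
  · rw [ha, swap_self]
    exact G.one_mem
  · refine SubmonoidClass.swap_mem_trans G (h a ha)
      (SubmonoidClass.swap_mem_trans G (swap_path_level_mem hg a) ?_)
    rw [swap_comm]
    exact h _ fun h' => ha (g.injective h')

theorem mem_of_fixes_cycle (hg : ∀ j, step j ∉ G → g ∈ levelSubgroup j)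
    (h : ∀ x, x ≠ 0 → g (Sum.inl x) = Sum.inl x) : g ∈ G := by
  refine mem_of_levelSubgroup hg fun a ha => ?_
  rcases a with x | i
  · by_cases hx : x = 0
    · rw [hx, level_inl, path_zero, swap_self]
      exact G.one_mem
    · exact absurd (h x hx) ha
  · rw [level_inr, path_succ, swap_self]
    exact G.one_mem

theorem refl_mem (h0 : refl 0 ∈ G) (h1 : refl 1 ∈ G) (c : ZMod k) : refl c ∈ G := by
  obtain ⟨n, rfl⟩ := ZMod.natCast_zmod_surjective c
  induction n with
  | zero => simpa using h0
  | succ n ih =>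
    convert G.mul_mem (G.mul_mem h1 h0) ih using 1
    ext a
    rcases a with x | i
    · simp only [Perm.mul_apply, refl_inl]
      congr 1
      push_cast
      ring
    · simp

theorem mem_of_dihedral (h0 : refl 0 ∈ G) (h1 : refl 1 ∈ G)
    (hg : ∀ j, step j ∉ G → g ∈ levelSubgroup j) (h : g ∈ dihedral k m) : g ∈ G := by
  obtain ⟨c, h | h⟩ := h
  · have hd : refl 0 * refl c ∈ G := G.mul_mem h0 (refl_mem h0 h1 c)
    rw [← G.mul_mem_cancel_left hd]
    refine mem_of_fixes_cycle (fun j hj => mul_mem (mul_mem (refl_mem_levelSubgroup _ j)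
      (refl_mem_levelSubgroup _ j)) (hg j hj)) fun x _ => ?_
    simp [h]
  · rw [← G.mul_mem_cancel_left (refl_mem h0 h1 c)]
    refine mem_of_fixes_cycle (fun j hj => mul_mem (refl_mem_levelSubgroup _ j)
      (hg j hj)) fun x _ => ?_
    simp [h]

theorem mem_of_refl_of_step_zero (h0 : refl 0 ∈ G) (h1 : refl 1 ∈ G) (h2 : step 0 ∈ G)
    (hg : ∀ j, step j ∉ G → g ∈ levelSubgroup j) : g ∈ G := by
  have hx : ∀ x, swap (Sum.inl x) (Sum.inr 0) ∈ G := fun x => by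
    have h : swap (refl x (Sum.inl 0)) (refl x (Sum.inr 0)) ∈ G :=
      swap_apply_mem (refl_mem h0 h1 x) h2
    rwa [refl_inl, sub_zero] at h
  refine mem_of_levelSubgroup hg fun a _ => ?_
  rcases a with x | i
  · refine SubmonoidClass.swap_mem_trans G (hx x) ?_
    rw [swap_comm]
    exact hx 0
  · rw [level_inr, path_succ, swap_self]
    exact G.one_mem

theorem mem_of_fixes_cycle_of_refl_one (hk : (2 : ZMod k) ≠ 0) (h1 : refl 1 ∈ G)
    (hg : ∀ j, step j ∉ G → g ∈ levelSubgroup j) (hd : step 0 ∉ G → g ∈ dihedral k m)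
    (h : ∀ x, x ≠ 0 → x ≠ 1 → g (Sum.inl x) = Sum.inl x) : g ∈ G := by
  by_cases h2 : step 0 ∈ G
  · refine mem_of_levelSubgroup hg fun a ha => ?_
    rcases a with x | i
    · by_cases hx0 : x = 0
      · rw [hx0, level_inl, path_zero, swap_self]
        exact G.one_mem
      by_cases hx1 : x = 1
      · have h3 : swap (Sum.inl 1) (Sum.inr 0) ∈ G := by
          have h : swap (refl 1 (Sum.inl 0)) (refl 1 (Sum.inr 0)) ∈ G := swap_apply_mem h1 h2
          rwa [refl_inl, sub_zero] at h
        subst hx1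
        refine SubmonoidClass.swap_mem_trans G h3 ?_
        rw [swap_comm]
        exact h2
      · exact absurd (h x hx0 hx1) ha
    · rw [level_inr, path_succ, swap_self]
      exact G.one_mem
  have hk1 : (-1 : ZMod k) ≠ 0 := fun h' => hk (by linear_combination -2 * h')
  have hk2 : (-1 : ZMod k) ≠ 1 := fun h' => hk (by linear_combination -h')
  obtain ⟨c, hc | hc⟩ := hd h2
  · have hc0 : c = 0 := by
      have := Sum.inl_injective ((hc (-1)).symm.trans (h (-1) hk1 hk2))
      linear_combination this
    exact mem_of_fixes_cycle hg fun x _ => by rw [hc, hc0, zero_add]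
  · have hc2 : c = -2 := by
      have := Sum.inl_injective ((hc (-1)).symm.trans (h (-1) hk1 hk2))
      linear_combination this
    have hc1 : c = 1 := by
      by_contra hne
      have := Sum.inl_injective ((hc c).symm.trans (h c (by simpa [hc2] using hk) hne))
      exact hk (by linear_combination this + hc2)
    rw [← G.mul_mem_cancel_left h1]
    refine mem_of_fixes_cycle (fun j hj => mul_mem (refl_mem_levelSubgroup _ j)
      (hg j hj)) fun x _ => ?_
    simp [hc, hc1]

end Membership

theorem mem_closure_gen [NeZero k] (hk : (2 : ZMod k) ≠ 0) (I : Set (Fin (m + 3)))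
    (g : Perm (Point k m)) (hI : ∀ i, i ∉ I → g ∈ maximalParabolic i) :
    g ∈ Subgroup.closure (gen '' I) := by
  set G := Subgroup.closure (gen (k := k) '' I)
  have hG : ∀ i ∈ I, gen i ∈ G := fun i hi => Subgroup.subset_closure ⟨i, hi, rfl⟩
  have hpar : ∀ j, step j ∉ G → g ∈ levelSubgroup j ⊓ ⨅ _ : j = 0, dihedral k m :=
    fun j hj => hI j.succ.succ fun h => hj (hG _ h)
  have hlev : ∀ j, step j ∉ G → g ∈ levelSubgroup j := fun j hj => (hpar j hj).1
  have hdih : step 0 ∉ G → g ∈ dihedral k m := fun h => by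
    simpa using (hpar 0 h).2
  have hlev' : ∀ c j, step j ∉ G → refl c * g ∈ levelSubgroup j := fun c j hj =>
    mul_mem (refl_mem_levelSubgroup c j) (hlev j hj)
  by_cases h1 : 1 ∈ I
  · have hB : refl 1 ∈ G := hG 1 h1
    by_cases h0 : 0 ∈ I
    · have hA : refl 0 ∈ G := hG 0 h0
      by_cases h2 : step 0 ∈ G
      · exact mem_of_refl_of_step_zero hA hB h2 hlev
      · exact mem_of_dihedral hA hB hlev (hdih h2)
    · rcases (hI 0 h0 : g ∈ almostReflection m 1) with h | h
      · exact mem_of_fixes_cycle_of_refl_one hk hB hlev hdih h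
      · rw [← G.mul_mem_cancel_left hB]
        exact mem_of_fixes_cycle_of_refl_one hk hB (hlev' 1)
          (fun h2 => mul_mem (refl_mem_dihedral 1) (hdih h2)) fun x hx0 hx1 => by
            simp [h x hx0 hx1]
  · rcases (hI 1 h1 : g ∈ almostReflection m 0) with h | h
    · exact mem_of_fixes_cycle hlev fun x hx => h x hx hx
    · by_cases h0 : 0 ∈ I
      · rw [← G.mul_mem_cancel_left (hG 0 h0 : refl 0 ∈ G)]
        exact mem_of_fixes_cycle (hlev' 0) fun x hx => by simp [h x hx hx]
      · exfalso
        have hk1 : (-1 : ZMod k) ≠ 0 := fun h' => hk (by linear_combination -2 * h')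
        have hk2 : (-1 : ZMod k) ≠ 1 := fun h' => hk (by linear_combination -h')
        have hg := h (-1) hk1 hk1
        rcases (hI 0 h0 : g ∈ almostReflection m 1) with h' | h'
        · have := Sum.inl_injective (hg.symm.trans (h' (-1) hk1 hk2))
          exact hk (by linear_combination this)
        · have := Sum.inl_injective (hg.symm.trans (h' (-1) hk1 hk2))
          exact hk1 (by linear_combination this)

theorem refl_ne_one (hk : (2 : ZMod k) ≠ 0) (c : ZMod k) : refl (m := m) c ≠ 1 := by
  intro h
  have h0 : c - 0 = 0 := Sum.inl_injective (congrArg (· (Sum.inl 0)) h)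
  have h1 : c - 1 = 1 := Sum.inl_injective (congrArg (· (Sum.inl 1)) h)
  exact hk (by linear_combination h0 - h1)

theorem refl_commute_step {c : ZMod k} {j : Fin (m + 1)} (h : c = 0 ∨ j ≠ 0) :
    Commute (refl c) (step j) := by
  rw [commute_iff_eq, ← mul_inv_eq_iff_eq_mul]
  have hsucc : refl c (path j.succ) = path j.succ := rfl
  have hcast : refl c (path j.castSucc) = path j.castSucc := by
    induction j using Fin.cases with
    | zero => simpa using h
    | succ i => rfl
  rw [step, ← swap_apply_apply, hsucc, hcast]

theorem step_commute_step {i j : Fin (m + 1)} (h : i.val + 1 < j.val) :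
    Commute (step (k := k) i) (step j) := by
  refine (Perm.disjoint_swap_swap ?_).commute
  have hnd : [i.castSucc, i.succ, j.castSucc, j.succ].Nodup := by
    simp [Fin.ext_iff]
    omega
  exact hnd.map path_injective

theorem isStringCGroupRep_gen [NeZero k] (hk : (2 : ZMod k) ≠ 0) :
    IsStringCGroupRep (gen (k := k) (m := m)) := by
  refine ⟨fun i => ?_, ?_, fun i j hij => ?_, closure_inf_closure_of_separating maximalParabolic
    gen_mem_maximalParabolic (mem_closure_gen hk)⟩
  · have hrefl : ∀ c : ZMod k, orderOf (refl (m := m) c) = 2 := fun c =>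
      orderOf_eq_prime (by rw [sq, refl_mul_refl_self]) (refl_ne_one hk c)
    induction i using Fin.cases with
    | zero => exact hrefl 0
    | succ i =>
      induction i using Fin.cases with
      | zero => exact hrefl 1
      | succ i =>
        refine orderOf_eq_prime (by rw [sq]; exact swap_mul_self _ _) ?_
        rw [gen_succ_succ, step, Ne, swap_eq_one_iff]
        exact path_injective.ne Fin.castSucc_lt_succ.ne
  · rw [← Set.image_univ, Subgroup.eq_top_iff']
    exact fun g => mem_closure_gen hk _ g fun i hi => absurd (Set.mem_univ i) hi
  · obtain ⟨j, rfl⟩ : ∃ j' : Fin (m + 1), j = j'.succ.succ :=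
      ⟨⟨j.val - 2, by omega⟩, by ext; simp; omega⟩
    induction i using Fin.cases with
    | zero => exact refl_commute_step (Or.inl rfl)
    | succ i =>
      induction i using Fin.cases with
      | zero =>
        have hj : 0 < j := by simpa using hij
        exact refl_commute_step (Or.inr hj.ne')
      | succ i => exact step_commute_step (by simpa using hij)

end CycleWithTail

/-- For every `n ≥ 4` and every `3 ≤ r ≤ n - 1`, the symmetric group `S_n` has a
string C-group representation of rank `r`. -/
theorem symmetricGroup_exists_all_ranks (n : ℕ) (hn : 4 ≤ n) (r : ℕ)
    (hr3 : 3 ≤ r) (hrn : r ≤ n - 1) :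
    ∃ ρ : Fin r → Equiv.Perm (Fin n), IsStringCGroupRep ρ := by
  obtain ⟨m, rfl⟩ : ∃ m, r = m + 3 := ⟨r - 3, by omega⟩
  obtain ⟨k, hk, rfl⟩ : ∃ k, 3 ≤ k ∧ n = k + (m + 1) := ⟨n - (m + 1), by omega, by omega⟩
  have : NeZero k := ⟨by omega⟩
  have h2 : (2 : ZMod k) ≠ 0 := by
    intro h
    have := (ZMod.natCast_eq_zero_iff 2 k).1 (by exact_mod_cast h)
    exact absurd (Nat.le_of_dvd two_pos this) (by omega)
  have e : CycleWithTail.Point k m ≃ Fin (k + (m + 1)) := Fintype.equivFinOfCardEq (by simp)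
  exact ⟨_, (CycleWithTail.isStringCGroupRep_gen h2).map e.permCongrHom⟩
end

section
/- For every integer n with n = 5 or n ≥ 9, the alternating group A_n has at least one string C-group representation of rank 3. -/
open Equiv MulAction

theorem mem_closure_singleton_of_sq {G : Type*} [Group G] {a g : G} (ha : a * a = 1)
    (hg : g ∈ Subgroup.closure {a}) : g = 1 ∨ g = a := by
  induction hg using Subgroup.closure_induction with
  | mem x hx => exact Or.inr hx
  | one => exact Or.inl rfl
  | mul x y _ _ hx hy => rcases hx with rfl | rfl <;> rcases hy with rfl | rfl <;> simp [ha]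
  | inv x _ hx => rcases hx with rfl | rfl <;> simp [inv_eq_of_mul_eq_one_left ha]

theorem mem_closure_pair_of_commute {G : Type*} [Group G] {a c g : G} (ha : a * a = 1)
    (hc : c * c = 1) (hac : Commute a c) (hg : g ∈ Subgroup.closure {a, c}) :
    g = 1 ∨ g = a ∨ g = c ∨ g = a * c := by
  obtain ⟨x, hx, y, hy, rfl⟩ : ∃ x, (x = 1 ∨ x = a) ∧ ∃ y, (y = 1 ∨ y = c) ∧ x * y = g := by
    induction hg using Subgroup.closure_induction with
    | mem x hx =>
      rcases hx with rfl | rfl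
      · exact ⟨x, .inr rfl, 1, .inl rfl, mul_one x⟩
      · exact ⟨1, .inl rfl, _, .inr rfl, one_mul _⟩
    | one => exact ⟨1, .inl rfl, 1, .inl rfl, mul_one 1⟩
    | mul g h _ _ hg hh =>
      obtain ⟨x, hx, y, hy, rfl⟩ := hg
      obtain ⟨x', hx', y', hy', rfl⟩ := hh
      refine ⟨x * x', ?_, y * y', ?_, ?_⟩
      · rcases hx with rfl | rfl <;> rcases hx' with rfl | rfl <;> simp [ha]
      · rcases hy with rfl | rfl <;> rcases hy' with rfl | rfl <;> simp [hc]
      · have : Commute x' y := by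
          rcases hy with rfl | rfl <;> rcases hx' with rfl | rfl <;> simp [hac]
        exact (this.mul_mul_mul_comm x y')
    | inv g _ hg =>
      obtain ⟨x, hx, y, hy, rfl⟩ := hg
      have : Commute x y := by
        rcases hy with rfl | rfl <;> rcases hx with rfl | rfl <;> simp [hac]
      refine ⟨x⁻¹, ?_, y⁻¹, ?_, by rw [this.eq, mul_inv_rev]⟩
      · rcases hx with rfl | rfl <;> simp [inv_eq_of_mul_eq_one_left ha]
      · rcases hy with rfl | rfl <;> simp [inv_eq_of_mul_eq_one_left hc]
  rcases hx with rfl | rfl <;> rcases hy with rfl | rfl <;> simp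

/-- In rank three, the intersection property follows from its instance for the two
maximal parabolic subgroups sharing the middle generator. -/
theorem isStringCGroupRep_of_inf_le {G : Type*} [Group G] {a b c : G}
    (ha : orderOf a = 2) (hb : orderOf b = 2) (hc : orderOf c = 2)
    (hgen : Subgroup.closure {a, b, c} = ⊤) (hac : Commute a c)
    (hab : a ≠ b) (hbc : b ≠ c) (hbac : b ≠ a * c)
    (h : ∀ g ∈ Subgroup.closure {a, b}, g ∈ Subgroup.closure {b, c} →
      g ∈ Subgroup.closure {b}) :
    IsStringCGroupRep ![a, b, c] := by
  have sq {x : G} (hx : orderOf x = 2) : x * x = 1 := by rw [← sq, ← hx, pow_orderOf_eq_one]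
  have ne1 {x : G} (hx : orderOf x = 2) : x ≠ 1 := by rintro rfl; simp at hx
  have ha2 := sq ha
  have hb2 := sq hb
  have hc2 := sq hc
  have ha1 := ne1 ha
  have hb1 := ne1 hb
  have hc1 := ne1 hc
  have a_notMem : a ∉ Subgroup.closure {b, c} := fun H => by
    rcases mem_closure_singleton_of_sq hb2 (h a (Subgroup.subset_closure (by simp)) H) with H | H
    exacts [ha1 H, hab H]
  have c_notMem : c ∉ Subgroup.closure {a, b} := fun H => by
    rcases mem_closure_singleton_of_sq hb2 (h c H (Subgroup.subset_closure (by simp))) with H | H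
    exacts [hc1 H, hbc H.symm]
  have hne : a ≠ c := fun H => a_notMem (H ▸ Subgroup.subset_closure (by simp))
  have h01_02 : ∀ g ∈ Subgroup.closure {a, b}, g ∈ Subgroup.closure {a, c} →
      g ∈ Subgroup.closure {a} := fun g h1 h2 => by
    rcases mem_closure_pair_of_commute ha2 hc2 hac h2 with rfl | rfl | rfl | rfl
    · exact one_mem _
    · exact Subgroup.subset_closure rfl
    · exact absurd h1 c_notMem
    · exact absurd ((Subgroup.mul_mem_cancel_left _
        (Subgroup.subset_closure (by simp))).1 h1) c_notMem
  have h02_12 : ∀ g ∈ Subgroup.closure {a, c}, g ∈ Subgroup.closure {b, c} →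
      g ∈ Subgroup.closure {c} := fun g h1 h2 => by
    rcases mem_closure_pair_of_commute ha2 hc2 hac h1 with rfl | rfl | rfl | rfl
    · exact one_mem _
    · exact absurd h2 a_notMem
    · exact Subgroup.subset_closure rfl
    · exact absurd ((Subgroup.mul_mem_cancel_right _
        (Subgroup.subset_closure (by simp))).1 h2) a_notMem
  have h0_12 : ∀ g ∈ Subgroup.closure {a}, g ∈ Subgroup.closure {b, c} → g = 1 :=
    fun g h1 h2 => (mem_closure_singleton_of_sq ha2 h1).resolve_right
      (fun H => a_notMem (H ▸ h2))
  have h2_01 : ∀ g ∈ Subgroup.closure {c}, g ∈ Subgroup.closure {a, b} → g = 1 :=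
    fun g h1 h2 => (mem_closure_singleton_of_sq hc2 h1).resolve_right
      (fun H => c_notMem (H ▸ h2))
  have h1_02 : ∀ g ∈ Subgroup.closure {b}, g ∈ Subgroup.closure {a, c} → g = 1 :=
    fun g h1 h2 => (mem_closure_singleton_of_sq hb2 h1).resolve_right (fun H => by
      rcases mem_closure_pair_of_commute ha2 hc2 hac h2 with H' | H' | H' | H' <;> grind)
  have hsingle {x y : G} (hx : x * x = 1) (hy : y * y = 1) (hxy : x ≠ y) :
      ∀ g ∈ Subgroup.closure {x}, g ∈ Subgroup.closure {y} → g = 1 := fun g h1 h2 => by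
    rcases mem_closure_singleton_of_sq hx h1 with H | H
    · exact H
    · exact (mem_closure_singleton_of_sq hy h2).resolve_right (fun H' => hxy (H ▸ H'))
  have sets : ∀ I : Set (Fin 3), I = ∅ ∨ I = {0} ∨ I = {1} ∨ I = {2} ∨ I = {0, 1} ∨
      I = {0, 2} ∨ I = {1, 2} ∨ I = Set.univ := fun I => by
    simp only [Set.ext_iff, Fin.forall_fin_succ]
    by_cases h0 : (0 : Fin 3) ∈ I <;> by_cases h1 : (1 : Fin 3) ∈ I <;>
      by_cases h2 : (2 : Fin 3) ∈ I <;> simp [h0, h1, h2]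
  refine ⟨?_, ?_, ?_, fun I J => ?_⟩
  · simp [Fin.forall_fin_succ, ha, hb, hc]
  · rw [← hgen]
    congr 1
    ext x
    simp only [Matrix.range_cons, Matrix.range_empty]
    simp [or_comm, or_left_comm]
  · intro i j hij
    obtain ⟨rfl, rfl⟩ : i = 0 ∧ j = 2 := by
      constructor <;> ext <;> simp only [Fin.isValue, Fin.val_zero, Fin.val_two] <;> omega
    exact hac
  · refine le_antisymm ?_ (le_inf (Subgroup.closure_mono (Set.image_mono Set.inter_subset_left))
      (Subgroup.closure_mono (Set.image_mono Set.inter_subset_right)))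
    by_cases hIJ : I ⊆ J
    · rw [Set.inter_eq_left.2 hIJ]
      exact inf_le_left
    by_cases hJI : J ⊆ I
    · rw [Set.inter_eq_right.2 hJI]
      exact inf_le_right
    rintro g ⟨hI, hJ⟩
    rcases sets I with rfl | rfl | rfl | rfl | rfl | rfl | rfl | rfl <;>
    rcases sets J with rfl | rfl | rfl | rfl | rfl | rfl | rfl | rfl <;>
    first
    | (refine absurd ?_ hIJ; simp; done)
    | (refine absurd ?_ hJI; simp; done)
    | (simp only [Subgroup.mem_toSubmonoid, Set.image_insert_eq, Set.image_singleton,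
        Matrix.cons_val, SetLike.mem_coe] at hI hJ
       first
       | (refine Subgroup.closure_mono ?_ (h g hI hJ)
          exact Set.singleton_subset_iff.2 ⟨1, by simp, rfl⟩)
       | (refine Subgroup.closure_mono ?_ (h g hJ hI)
          exact Set.singleton_subset_iff.2 ⟨1, by simp, rfl⟩)
       | (refine Subgroup.closure_mono ?_ (h01_02 g hI hJ)
          exact Set.singleton_subset_iff.2 ⟨0, by simp, rfl⟩)
       | (refine Subgroup.closure_mono ?_ (h01_02 g hJ hI)
          exact Set.singleton_subset_iff.2 ⟨0, by simp, rfl⟩)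
       | (refine Subgroup.closure_mono ?_ (h02_12 g hI hJ)
          exact Set.singleton_subset_iff.2 ⟨2, by simp, rfl⟩)
       | (refine Subgroup.closure_mono ?_ (h02_12 g hJ hI)
          exact Set.singleton_subset_iff.2 ⟨2, by simp, rfl⟩)
       | (obtain rfl : g = 1 := by
            first
            | exact h0_12 g hI hJ
            | exact h0_12 g hJ hI
            | exact h1_02 g hI hJ
            | exact h1_02 g hJ hI
            | exact h2_01 g hI hJ
            | exact h2_01 g hJ hI
            | exact hsingle ha2 hb2 hab g hI hJ
            | exact hsingle ha2 hb2 hab g hJ hI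
            | exact hsingle hb2 hc2 hbc g hI hJ
            | exact hsingle hb2 hc2 hbc g hJ hI
            | exact hsingle ha2 hc2 hne g hI hJ
            | exact hsingle ha2 hc2 hne g hJ hI
          exact one_mem _))

/-- If `b` and `c` are involutions and `b ∈ H`, then `H` meets the dihedral group `⟨b, c⟩` in `⟨b⟩`
as soon as it contains no nontrivial element of `⟨b, c⟩` commuting with `b * c`. -/
theorem mem_closure_singleton_of_commute_imp {G : Type*} [Group G] {b c : G} {H : Subgroup G}
    (hb : b * b = 1) (hc : c * c = 1) (hbH : b ∈ H)
    (h : ∀ g ∈ H, g ∈ Subgroup.closure {b, c} → Commute g (b * c) → g = 1) :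
    ∀ g ∈ H, g ∈ Subgroup.closure {b, c} → g ∈ Subgroup.closure {b} := by
  have hinv : (b * c)⁻¹ = c * b := by
    rw [mul_inv_rev, inv_eq_of_mul_eq_one_left hb, inv_eq_of_mul_eq_one_left hc]
  have hbs : SemiconjBy b (b * c) (b * c)⁻¹ := by
    rw [hinv, SemiconjBy, ← mul_assoc, hb, mul_assoc, hb, one_mul, mul_one]
  have key : ∀ g ∈ Subgroup.closure {b, c},
      Commute g (b * c) ∨ SemiconjBy g (b * c) (b * c)⁻¹ := fun g hg => by
    induction hg using Subgroup.closure_induction with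
    | mem x hx =>
      rcases hx with rfl | rfl
      · exact .inr hbs
      · exact .inr (by rw [hinv, SemiconjBy, ← mul_assoc])
    | one => exact .inl (Commute.one_left _)
    | mul x y _ _ hx hy =>
      rcases hx with hx | hx <;> rcases hy with hy | hy
      · exact .inl (hx.mul_left hy)
      · exact .inr (SemiconjBy.mul_left (SemiconjBy.inv_right hx) hy)
      · exact .inr (SemiconjBy.mul_left hx hy)
      · exact .inl (by rw [Commute]; simpa using SemiconjBy.mul_left (SemiconjBy.inv_right hx) hy)
    | inv x _ hx =>
      rcases hx with hx | hx
      · exact .inl hx.inv_left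
      · exact .inr (by simpa using (SemiconjBy.inv_right hx).inv_symm_left)
  intro g hgH hg
  have hb' : b ∈ Subgroup.closure {b} := Subgroup.subset_closure rfl
  have hbc : b ∈ Subgroup.closure {b, c} := Subgroup.subset_closure (by simp)
  rcases key g hg with hk | hk
  · rw [h g hgH hg hk]
    exact one_mem _
  · have := h (g * b) (mul_mem hgH hbH) (mul_mem hg hbc)
      (by rw [Commute]; simpa using SemiconjBy.mul_left (SemiconjBy.inv_right hk) hbs)
    rw [eq_inv_of_mul_eq_one_left this]
    exact inv_mem hb'

/-- A permutation group is primitive as soon as it contains a 3-cycle `t` moving a point `x`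
such that no proper invariant equivalence relation identifies `x` and `t x`. -/
theorem isPreprimitive_of_isThreeCycle {α : Type*} [DecidableEq α] (G : Subgroup (Perm α))
    {x y z : α} (ht : swap x z * swap x y ∈ G) (hxy : x ≠ y) (hxz : x ≠ z) (hyz : y ≠ z)
    (h : ∀ B : Set α, (∀ g ∈ G, g x ∈ B ↔ g y ∈ B) → ∀ p, x ∈ B ↔ p ∈ B) :
    IsPreprimitive G α := by
  set t : G := ⟨swap x z * swap x y, ht⟩ with ht_def
  have smul_t (w : α) : t • w = swap x z (swap x y w) := rfl
  have tx : t • x = y := by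
    rw [smul_t, swap_apply_left, swap_apply_of_ne_of_ne hxy.symm hyz]
  have tz : t • z = x := by
    rw [smul_t, swap_apply_of_ne_of_ne hxz.symm hyz.symm, swap_apply_right]
  have tw {w : α} (hx : w ≠ x) (hy : w ≠ y) (hz : w ≠ z) : t • w = w := by
    rw [smul_t, swap_apply_of_ne_of_ne hx hy, swap_apply_of_ne_of_ne hx hz]
  have key {B : Set α} (hB : IsBlock G B) (hx : x ∈ B) (hy : y ∈ B) : B = Set.univ := by
    have hg (g : G) {p q : α} (hp : p ∈ B) (hq : q ∈ B) (hgp : g • p ∈ B) : g • q ∈ B := by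
      have := hB.smul_eq_of_mem hp hgp
      exact this ▸ Set.smul_mem_smul_set hq
    refine Set.eq_univ_of_forall fun p => (h B (fun g hgG => ⟨?_, ?_⟩) p).1 hx
    · exact hg ⟨g, hgG⟩ hx hy
    · exact hg ⟨g, hgG⟩ hy hx
  have horb : orbit G x = Set.univ :=
    key (IsBlock.orbit x) (mem_orbit_self x) ⟨t, tx⟩
  have : IsPretransitive G α := isPretransitive_iff_orbit_eq_univ x |>.2 horb
  refine IsPreprimitive.of_isTrivialBlock_base x fun {B} hx hB => ?_
  refine or_iff_not_imp_left.2 fun hns => ?_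
  obtain ⟨w, hw, hwx⟩ : ∃ w ∈ B, w ≠ x := by
    by_contra! hcon
    exact hns fun p hp q hq => (hcon p hp).trans (hcon q hq).symm
  refine key hB hx ?_
  by_cases hwy : w = y
  · exact hwy ▸ hw
  have htB : t • w ∈ B := by
    by_cases hwz : w = z
    · rw [hwz, tz]
      exact hx
    · rwa [tw hwx hwy hwz]
  rw [← tx, ← hB.smul_eq_of_mem hw htB]
  exact Set.smul_mem_smul_set hx

/-- The permutation of `Fin n` induced by a map on `ℕ` that is an involution below `n`. -/
def involutionPerm (n : ℕ) (f : ℕ → ℕ) (hf : ∀ i < n, f i < n ∧ f (f i) = i) : Perm (Fin n) :=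
  Function.Involutive.toPerm (fun i => ⟨f i, (hf i i.2).1⟩) fun i => Fin.ext (hf i i.2).2

theorem involutionPerm_val {n : ℕ} {f : ℕ → ℕ} (hf : ∀ i < n, f i < n ∧ f (f i) = i)
    (i : Fin n) : (involutionPerm n f hf i : ℕ) = f i := rfl

theorem involutionPerm_mul_self {n : ℕ} {f : ℕ → ℕ} (hf : ∀ i < n, f i < n ∧ f (f i) = i) :
    involutionPerm n f hf * involutionPerm n f hf = 1 :=
  Equiv.ext fun i => Fin.ext (hf i i.2).2

theorem involutionPerm_mem_alternatingGroup {n : ℕ} {f : ℕ → ℕ}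
    (hf : ∀ i < n, f i < n ∧ f (f i) = i)
    (hcard : n % 4 = ((Finset.range n).filter fun i => f i = i).card % 4) :
    involutionPerm n f hf ∈ alternatingGroup (Fin n) := by
  rw [Perm.mem_alternatingGroup, Perm.sign_of_pow_two_eq_one
    (by rw [sq, involutionPerm_mul_self])]
  have : Fintype.card (Function.fixedPoints (involutionPerm n f hf)) =
      ((Finset.range n).filter fun i => f i = i).card := by
    rw [Fintype.card_subtype, ← Finset.card_map Fin.valEmbedding]
    congr 1
    ext i
    simp only [Finset.mem_map, Finset.mem_filter, Finset.mem_univ, true_and, Finset.mem_range,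
      Function.mem_fixedPoints, Function.IsFixedPt, Fin.ext_iff, involutionPerm_val]
    exact ⟨by rintro ⟨j, hj, rfl⟩; exact ⟨j.2, hj⟩, fun ⟨hi, hfi⟩ => ⟨⟨i, hi⟩, hfi, rfl⟩⟩
  rw [this, Fintype.card_fin]
  refine Even.neg_one_pow ?_
  rw [Nat.even_iff]
  have := (Finset.card_filter_le (Finset.range n) fun i => f i = i).trans_eq (Finset.card_range n)
  omega

/-- A criterion for three involutions of `{0, …, n - 1}`, given as maps on `ℕ`, to yield a string
C-group representation of the alternating group. -/
theorem exists_isStringCGroupRep_of_involutions (n : ℕ) (a b c : ℕ → ℕ)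
    (ha : ∀ i < n, a i < n ∧ a (a i) = i) (hb : ∀ i < n, b i < n ∧ b (b i) = i)
    (hc : ∀ i < n, c i < n ∧ c (c i) = i)
    (ca : n % 4 = ((Finset.range n).filter fun i => a i = i).card % 4)
    (cb : n % 4 = ((Finset.range n).filter fun i => b i = i).card % 4)
    (cc : n % 4 = ((Finset.range n).filter fun i => c i = i).card % 4)
    (hac : ∀ i < n, a (c i) = c (a i)) (hc1 : ∃ i < n, c i ≠ i)
    {x y z : ℕ} (hx : x < n) (hy : y < n) (hz : z < n) (hxy : x ≠ y) (hxz : x ≠ z) (hyz : y ≠ z)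
    (h3x : (fun i => a (b i))^[4] x = y) (h3y : (fun i => a (b i))^[4] y = z)
    (h3z : (fun i => a (b i))^[4] z = x)
    (h3 : ∀ i < n, i ≠ x → i ≠ y → i ≠ z → (fun i => a (b i))^[4] i = i)
    (hR : ∀ R : ℕ → ℕ → Prop, Equivalence R →
      (∀ p < n, ∀ q < n, R p q → R (a p) (a q) ∧ R (b p) (b q) ∧ R (c p) (c q)) →
      R x y → ∀ p < n, R x p)
    (hI : ∀ g : ℕ → ℕ, (∀ i < n, g i < n) → (∀ i < n, ∀ j < n, g i = g j → i = j) →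
      (∀ S : ℕ → Prop, (∀ i < n, S i → S (a i) ∧ S (b i)) → ∀ i < n, S i → S (g i)) →
      (∀ S : ℕ → Prop, (∀ i < n, S i → S (b i) ∧ S (c i)) → ∀ i < n, S i → S (g i)) →
      (∀ i < n, g (b (c i)) = b (c (g i))) → ∀ i < n, g i = i) :
    ∃ ρ : Fin 3 → alternatingGroup (Fin n), IsStringCGroupRep ρ := by
  set A : alternatingGroup (Fin n) :=
    ⟨involutionPerm n a ha, involutionPerm_mem_alternatingGroup ha ca⟩
  set B : alternatingGroup (Fin n) :=
    ⟨involutionPerm n b hb, involutionPerm_mem_alternatingGroup hb cb⟩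
  set C : alternatingGroup (Fin n) :=
    ⟨involutionPerm n c hc, involutionPerm_mem_alternatingGroup hc cc⟩
  have C_val (i : Fin n) : (C.1 i : ℕ) = c i := rfl
  have A2 : A * A = 1 := Subtype.ext (involutionPerm_mul_self ha)
  have B2 : B * B = 1 := Subtype.ext (involutionPerm_mul_self hb)
  have C2 : C * C = 1 := Subtype.ext (involutionPerm_mul_self hc)
  have AC : Commute A C := Subtype.ext (Equiv.ext fun i => Fin.ext (hac i i.2))
  have iter_val (k : ℕ) (i : Fin n) : ((((A * B) ^ k).1 i : Fin n) : ℕ) =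
      (fun i => a (b i))^[k] i := by
    induction k generalizing i with
    | zero => rfl
    | succ k ih =>
      rw [pow_succ, Function.iterate_succ_apply]
      exact ih (A.1 (B.1 i))
  have htriple : ((A * B) ^ 4).1 = swap (⟨x, hx⟩ : Fin n) ⟨z, hz⟩ * swap ⟨x, hx⟩ ⟨y, hy⟩ := by
    ext i
    rw [iter_val, Perm.mul_apply]
    by_cases hix : i = ⟨x, hx⟩
    · rw [hix, swap_apply_left, swap_apply_of_ne_of_ne (by simpa using hxy.symm)
        (by simpa using hyz), h3x]
    by_cases hiy : i = ⟨y, hy⟩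
    · rw [hiy, swap_apply_right, swap_apply_left, h3y]
    rw [swap_apply_of_ne_of_ne hix hiy]
    by_cases hiz : i = ⟨z, hz⟩
    · rw [hiz, swap_apply_right, h3z]
    rw [swap_apply_of_ne_of_ne hix hiz]
    exact h3 i i.2 (fun h => hix (Fin.ext h)) (fun h => hiy (Fin.ext h)) (fun h => hiz (Fin.ext h))
  have hAB4 : (A * B) ^ 4 ≠ 1 := fun H => by
    have := iter_val 4 ⟨x, hx⟩
    rw [H, h3x] at this
    exact hxy this
  have hAB2 : (A * B) * (A * B) ≠ 1 := fun H => hAB4 (by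
    rw [show 4 = 2 * 2 from rfl, pow_mul, sq (A * B), H, one_pow])
  have order_two {g : alternatingGroup (Fin n)} (h : g * g = 1) (h1 : g ≠ 1) : orderOf g = 2 :=
    orderOf_eq_prime (by rw [sq, h]) h1
  refine ⟨![A, B, C], isStringCGroupRep_of_inf_le (order_two A2 ?_) (order_two B2 ?_)
    (order_two C2 ?_) ?_ AC ?_ ?_ ?_ ?_⟩
  · rintro H
    exact hAB2 (by rw [H, one_mul, B2])
  · rintro H
    exact hAB2 (by rw [H, mul_one, A2])
  · obtain ⟨i, hi, hci⟩ := hc1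
    rintro H
    have := C_val ⟨i, hi⟩
    rw [H] at this
    exact hci this.symm
  · have hmap : (Subgroup.closure {A, B, C}).map (alternatingGroup (Fin n)).subtype =
        Subgroup.closure {A.1, B.1, C.1} := by
      rw [MonoidHom.map_closure, Set.image_insert_eq, Set.image_insert_eq, Set.image_singleton]
      rfl
    set G := Subgroup.closure {A.1, B.1, C.1}
    have hAG : A.1 ∈ G := Subgroup.subset_closure (by simp)
    have hBG : B.1 ∈ G := Subgroup.subset_closure (by simp)
    have hCG : C.1 ∈ G := Subgroup.subset_closure (by simp)
    have htG : swap (⟨x, hx⟩ : Fin n) ⟨z, hz⟩ * swap ⟨x, hx⟩ ⟨y, hy⟩ ∈ G :=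
      htriple ▸ pow_mem (mul_mem hAG hBG) 4
    have hxy' : (⟨x, hx⟩ : Fin n) ≠ ⟨y, hy⟩ := by simpa using hxy
    have hxz' : (⟨x, hx⟩ : Fin n) ≠ ⟨z, hz⟩ := by simpa using hxz
    have hyz' : (⟨y, hy⟩ : Fin n) ≠ ⟨z, hz⟩ := by simpa using hyz
    have hprim : IsPreprimitive G (Fin n) := by
      refine isPreprimitive_of_isThreeCycle G htG hxy' hxz' hyz' fun T hT p => ?_
      have := hR (fun p q => ∀ g ∈ G, (∃ h : p < n, g ⟨p, h⟩ ∈ T) ↔ ∃ h : q < n, g ⟨q, h⟩ ∈ T)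
        ⟨fun _ _ _ => Iff.rfl, fun h g hg => (h g hg).symm,
          fun h h' g hg => (h g hg).trans (h' g hg)⟩
        (fun p hp q hq hpq => ⟨fun g hg => ?_, fun g hg => ?_, fun g hg => ?_⟩)
        (fun g hg => by simpa [hx, hy] using hT g hg) p p.2 1 (one_mem G)
      · simpa [hx, p.2] using this
      · have := hpq (g * A.1) (mul_mem hg hAG)
        simp only [hp, hq, exists_true_left] at this
        simp only [(ha p hp).1, (ha q hq).1, exists_true_left]
        exact this
      · have := hpq (g * B.1) (mul_mem hg hBG)
        simp only [hp, hq, exists_true_left] at this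
        simp only [(hb p hp).1, (hb q hq).1, exists_true_left]
        exact this
      · have := hpq (g * C.1) (mul_mem hg hCG)
        simp only [hp, hq, exists_true_left] at this
        simp only [(hc p hp).1, (hc q hq).1, exists_true_left]
        exact this
    have hle := Perm.alternatingGroup_le_of_isPreprimitive_of_isThreeCycle_mem hprim
      (Perm.isThreeCycle_swap_mul_swap_same hxz' hxy' hyz'.symm) htG
    rw [eq_top_iff]
    intro g _
    obtain ⟨g', hg', h⟩ := hmap.ge (hle g.2)
    rwa [← Subtype.ext h]
  · intro H
    exact hAB2 (by rw [H, B2, one_mul])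
  · intro H
    refine hAB2 ?_
    rw [← H] at AC
    rw [AC.symm.mul_mul_mul_comm, A2, B2, one_mul]
  · intro H
    have hAB : A * B = C := by rw [H, ← mul_assoc, A2, one_mul]
    exact hAB2 (by rw [hAB, C2])
  · refine mem_closure_singleton_of_commute_imp B2 C2 (Subgroup.subset_closure (by simp))
      fun g hg1 hg2 hg => ?_
    have invariant {u v g : alternatingGroup (Fin n)} (hg : g ∈ Subgroup.closure {u, v})
        (hu : u * u = 1) (hv : v * v = 1) (S : ℕ → Prop)
        (hS : ∀ i : Fin n, S i → S (u.1 i) ∧ S (v.1 i)) : ∀ i : Fin n, S i → S (g.1 i) := by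
      have key : ∀ i : Fin n, S i ↔ S (g.1 i) := by
        induction hg using Subgroup.closure_induction with
        | mem w hw =>
          have hw' : w * w = 1 ∧ ∀ i : Fin n, S i → S (w.1 i) := by
            rcases hw with rfl | rfl
            · exact ⟨hu, fun i hi => (hS i hi).1⟩
            · exact ⟨hv, fun i hi => (hS i hi).2⟩
          refine fun i => ⟨hw'.2 i, fun h => ?_⟩
          have hwi : w.1 (w.1 i) = i :=
            congrArg (fun s : alternatingGroup (Fin n) => s.1 i) hw'.1
          simpa [hwi] using hw'.2 _ h
        | one => exact fun i => Iff.rfl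
        | mul p q _ _ hp hq => exact fun i => (hq i).trans (hp (q.1 i))
        | inv p _ hp =>
          intro i
          have hpi : p.1 ((p⁻¹).1 i) = i := p.1.apply_symm_apply i
          have := hp ((p⁻¹).1 i)
          rw [hpi] at this
          exact this.symm
      exact fun i => (key i).1
    let γ : ℕ → ℕ := fun i => if h : i < n then g.1 ⟨i, h⟩ else i
    have γ_val (i : ℕ) (hi : i < n) : γ i = g.1 ⟨i, hi⟩ := dif_pos hi
    have hγ := hI γ (fun i hi => by rw [γ_val i hi]; exact Fin.is_lt _)
      (fun i hi j hj hij => by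
        rw [γ_val i hi, γ_val j hj] at hij
        simpa using g.1.injective (Fin.ext hij))
      (fun S hS i hi hSi => by
        rw [γ_val i hi]
        exact invariant hg1 A2 B2 S (fun i => hS i i.2) ⟨i, hi⟩ hSi)
      (fun S hS i hi hSi => by
        rw [γ_val i hi]
        exact invariant hg2 B2 C2 S (fun i => hS i i.2) ⟨i, hi⟩ hSi)
      (fun i hi => by
        rw [γ_val i hi, γ_val _ (hb _ (hc i hi).1).1]
        exact congrArg (fun s : alternatingGroup (Fin n) => (s.1 ⟨i, hi⟩ : ℕ)) hg)
    exact Subtype.ext (Equiv.ext fun i => Fin.ext ((γ_val i i.2).symm.trans (hγ i i.2)))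

theorem mod_four_eq_card_fixed_of_support {n : ℕ} {f : ℕ → ℕ} {s : Finset ℕ}
    (hs : ∀ i, i ∈ s ↔ i < n ∧ f i ≠ i) (h : s.card % 4 = 0) :
    n % 4 = ((Finset.range n).filter fun i => f i = i).card % 4 := by
  have h1 := Finset.card_filter_add_card_filter_not (s := Finset.range n) (fun i => f i = i)
  have h2 : (Finset.range n).filter (fun i => ¬ f i = i) = s := by
    ext i
    simp [hs]
  rw [h2, Finset.card_range] at h1
  omega

theorem mod_four_eq_card_fixed {n : ℕ} {f : ℕ → ℕ} {s : Finset ℕ}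
    (hs : ∀ i, i ∈ s ↔ i < n ∧ f i = i) (h : n % 4 = s.card % 4) :
    n % 4 = ((Finset.range n).filter fun i => f i = i).card % 4 := by
  have h2 : (Finset.range n).filter (fun i => f i = i) = s := by
    ext i
    simp [hs]
  rwa [h2]

/-- The involutions are `(0 1)(3 4)`, `(1 2)(3 4)` and `(0 3)(1 4)`. -/
theorem exists_isStringCGroupRep_five :
    ∃ ρ : Fin 3 → alternatingGroup (Fin 5), IsStringCGroupRep ρ := by
  obtain ⟨a, ha⟩ : ∃ a : ℕ → ℕ, a 0 = 1 ∧ a 1 = 0 ∧ a 2 = 2 ∧ a 3 = 4 ∧ a 4 = 3 :=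
    ⟨fun i => [1, 0, 2, 4, 3].getD i 0, by decide⟩
  obtain ⟨b, hb⟩ : ∃ b : ℕ → ℕ, b 0 = 0 ∧ b 1 = 2 ∧ b 2 = 1 ∧ b 3 = 4 ∧ b 4 = 3 :=
    ⟨fun i => [0, 2, 1, 4, 3].getD i 0, by decide⟩
  obtain ⟨c, hc⟩ : ∃ c : ℕ → ℕ, c 0 = 3 ∧ c 1 = 4 ∧ c 2 = 2 ∧ c 3 = 0 ∧ c 4 = 1 :=
    ⟨fun i => [3, 4, 2, 0, 1].getD i 0, by decide⟩
  have five {P : ℕ → Prop} (h : P 0 ∧ P 1 ∧ P 2 ∧ P 3 ∧ P 4) : ∀ i < 5, P i := fun i hi => by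
    obtain ⟨h0, h1, h2, h3, h4⟩ := h
    interval_cases i <;> assumption
  refine exists_isStringCGroupRep_of_involutions 5 a b c (five (by simp [ha]))
    (five (by simp [hb])) (five (by simp [hc]))
    (by simp [Finset.filter_insert, Finset.filter_singleton,
      Finset.range_add_one, ha])
    (by simp [Finset.filter_insert, Finset.filter_singleton,
      Finset.range_add_one, hb])
    (by simp [Finset.filter_insert, Finset.filter_singleton,
      Finset.range_add_one, hc])
    (five (by simp [ha, hc])) ⟨0, by simp [hc]⟩
    (x := 0) (y := 1) (z := 2) (by simp) (by simp) (by simp) (by simp) (by simp) (by simp)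
    (by simp [ha, hb]) (by simp [ha, hb]) (by simp [ha, hb])
    (five (by simp [ha, hb])) (fun R hR h h01 => ?_) (fun g hg inj hab _ hr => ?_)
  · have h02 : R 0 2 := by simpa [hb] using (h 0 (by simp) 1 (by simp) h01).2.1
    have h32 : R 3 2 := by simpa [hc] using (h 0 (by simp) 2 (by simp) h02).2.2
    have h34 : R 3 4 := by simpa [hc] using (h 0 (by simp) 1 (by simp) h01).2.2
    have h03 := hR.trans h02 (hR.symm h32)
    exact five ⟨hR.refl 0, h01, h02, h03, hR.trans h03 h34⟩
  · have hS := hab (· < 3) (five (by simp [ha, hb]))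
    have r0 := hr 0 (by simp)
    have r1 := hr 1 (by simp)
    have r2 := hr 2 (by simp)
    have r4 := hr 4 (by simp)
    simp only [hb, hc] at r0 r1 r2 r4
    have s1 := hS 1 (by simp) (by simp)
    have s2 := hS 2 (by simp) (by simp)
    have s0 := hS 0 (by simp) (by simp)
    obtain h0 | h0 | h0 : g 0 = 0 ∨ g 0 = 1 ∨ g 0 = 2 := by omega
    all_goals
      simp only [h0, hb, hc] at r0
      simp only [r0, hb, hc] at r4
      simp only [r4, hb, hc] at r2
      simp only [r2, hb, hc] at r1
    · exact five ⟨h0, r2, r4, r1, r0⟩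
    · omega
    · omega

/-- An equivalence relation preserved by `b` and `c` that relates `x` to every `p ≤ m` relates `x`
to everything below `n`, provided each `p > m` is reached by a map taking smaller values. -/
theorem rel_of_le_of_step {n m x : ℕ} {b c : ℕ → ℕ} {R : ℕ → ℕ → Prop} (hR : Equivalence R)
    (hbc : ∀ p < n, ∀ q < n, R p q → R (b p) (b q) ∧ R (c p) (c q))
    (base : ∀ p ≤ m, R x p)
    (step : ∀ p, m < p → p < n →
      ∃ q < p, ∃ q' < p, b q = p ∧ b q' < p ∨ c q = p ∧ c q' < p) : ∀ p < n, R x p := by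
  intro p
  induction p using Nat.strong_induction_on with
  | _ p ih =>
    intro hp
    rcases le_or_gt p m with hm | hm
    · exact base p hm
    obtain ⟨q, hq, q', hq', h⟩ := step p hm hp
    have hqq := hbc q' (by omega) q (by omega)
      (hR.trans (hR.symm (ih q' hq' (by omega))) (ih q hq (by omega)))
    rcases h with ⟨h, h'⟩ | ⟨h, h'⟩
    · exact hR.trans (ih _ h' (by omega)) (h ▸ hqq.1)
    · exact hR.trans (ih _ h' (by omega)) (h ▸ hqq.2)

/-- A map commuting with `b ∘ c` that fixes every `i ≤ m` fixes everything below `n`, provided each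
`j > m` is a `b ∘ c`-neighbour of a smaller point. -/
theorem eq_of_le_of_step {n m : ℕ} {b c g : ℕ → ℕ}
    (hb : ∀ i < n, b i < n ∧ b (b i) = i) (hc : ∀ i < n, c i < n ∧ c (c i) = i)
    (hg : ∀ i < n, g i < n) (hr : ∀ i < n, g (b (c i)) = b (c (g i)))
    (base : ∀ i ≤ m, g i = i)
    (step : ∀ j, m < j → j < n → ∃ i < j, b (c i) = j ∨ b (c j) = i) : ∀ j < n, g j = j := by
  intro j
  induction j using Nat.strong_induction_on with
  | _ j ih =>
    intro hj
    rcases le_or_gt j m with hm | hm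
    · exact base j hm
    obtain ⟨i, hi, h | h⟩ := step j hm hj
    · rw [← h, hr i (by omega), ih i hi (by omega)]
    · have h1 := hr j hj
      rw [h, ih i hi (by omega), ← h] at h1
      have h2 := congrArg b h1
      rw [(hb _ (hc j hj).1).2, (hb _ (hc _ (hg j hj)).1).2] at h2
      have h3 := congrArg c h2
      rw [(hc j hj).2, (hc _ (hg j hj)).2] at h3
      exact h3.symm

/-- The involutions are `(0 1)(4 5)`, `(1 2)(3 4)(5 6)⋯` and `(2 3)(4 5)⋯`, the last one multiplied
by `(0 1)` if `n % 4 = 1`. -/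
theorem exists_isStringCGroupRep_of_mod_four_eq_one_or_two {n : ℕ} (hn : 9 ≤ n)
    (hmod : n % 4 = 1 ∨ n % 4 = 2) :
    ∃ ρ : Fin 3 → alternatingGroup (Fin n), IsStringCGroupRep ρ := by
  obtain ⟨a, ha⟩ : ∃ a : ℕ → ℕ, ∀ i, a i = if i = 0 then 1 else if i = 1 then 0 else
      if i = 4 then 5 else if i = 5 then 4 else i := ⟨_, fun _ => rfl⟩
  obtain ⟨b, hb⟩ : ∃ b : ℕ → ℕ, ∀ i, b i = if i % 2 = 1 then (if i + 1 < n then i + 1 else i)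
      else i - 1 := ⟨_, fun _ => rfl⟩
  obtain ⟨c, hc⟩ : ∃ c : ℕ → ℕ, ∀ i, c i = if i < 2 ∧ n % 4 = 2 then i else
      if i % 2 = 0 then (if i + 1 < n then i + 1 else i) else i - 1 := ⟨_, fun _ => rfl⟩
  have a_small : a 0 = 1 ∧ a 1 = 0 ∧ a 2 = 2 ∧ a 3 = 3 ∧ a 4 = 5 ∧ a 5 = 4 ∧ a 6 = 6 := by
    simp [ha]
  have b_small : b 0 = 0 ∧ b 1 = 2 ∧ b 2 = 1 ∧ b 3 = 4 ∧ b 4 = 3 ∧ b 5 = 6 ∧ b 6 = 5 := by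
    simp [hb]
    omega
  have c_small : c 2 = 3 ∧ c 3 = 2 ∧ c 4 = 5 ∧ c 5 = 4 := by
    simp [hc]
    omega
  have c_one : c 0 = 1 ∧ c 1 = 0 ∨ c 0 = 0 ∧ c 1 = 1 := by
    rcases hmod with h | h <;> simp [hc, h]
    omega
  have a_eq (i : ℕ) (h : 6 ≤ i) : a i = i := by
    rw [ha]
    split_ifs <;> omega
  have b_odd (i : ℕ) (h : i % 2 = 1) (hi : i + 1 < n) : b i = i + 1 := by
    rw [hb, if_pos h, if_pos hi]
  have b_even (i : ℕ) (h : i % 2 = 0) : b i = i - 1 := by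
    rw [hb, if_neg (by omega)]
  have c_odd (i : ℕ) (h : i % 2 = 1) (hi : 2 ≤ i) : c i = i - 1 := by
    rw [hc, if_neg (by omega), if_neg (by omega)]
  have c_even (i : ℕ) (h : i % 2 = 0) (h2 : 2 ≤ i) (hi : i + 1 < n) : c i = i + 1 := by
    rw [hc, if_neg (by omega), if_pos h, if_pos hi]
  have ha_inv : ∀ i < n, a i < n ∧ a (a i) = i := fun i hi => by
    rcases lt_or_ge i 6 with h6 | h6
    · interval_cases i <;> simp [a_small] <;> omega
    · rw [a_eq i h6, a_eq i h6]
      exact ⟨hi, rfl⟩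
  have hb_inv : ∀ i < n, b i < n ∧ b (b i) = i := fun i hi => by
    rcases Nat.mod_two_eq_zero_or_one i with h | h
    · rw [b_even i h]
      rcases Nat.eq_zero_or_pos i with rfl | h0
      · simp [b_small, hi]
      · rw [b_odd (i - 1) (by omega) (by omega)]
        omega
    · rcases lt_or_ge (i + 1) n with hin | hin
      · rw [b_odd i h hin, b_even (i + 1) (by omega)]
        omega
      · have : b i = i := by rw [hb, if_pos h, if_neg (by omega)]
        rw [this, this]
        exact ⟨hi, rfl⟩
  have hc_inv : ∀ i < n, c i < n ∧ c (c i) = i := fun i hi => by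
    rcases lt_or_ge i 2 with h2 | h2
    · interval_cases i <;> rcases c_one with h | h <;> simp [h] <;> omega
    rcases Nat.mod_two_eq_zero_or_one i with h | h
    · rcases lt_or_ge (i + 1) n with hin | hin
      · rw [c_even i h h2 hin, c_odd (i + 1) (by omega) (by omega)]
        omega
      · have : c i = i := by rw [hc, if_neg (by omega), if_pos h, if_neg (by omega)]
        rw [this, this]
        exact ⟨hi, rfl⟩
    · rw [c_odd i h h2]
      rcases lt_or_ge (i - 1) 2 with h3 | h3
      · omega
      · rw [c_even (i - 1) (by omega) h3 (by omega)]
        omega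
  have b_le (i : ℕ) (h : 7 ≤ i) : 7 ≤ b i := by
    rw [hb]
    split_ifs <;> omega
  have c_le (i : ℕ) (h : 6 ≤ i) : 6 ≤ c i := by
    rw [hc]
    split_ifs <;> omega
  have hac (i : ℕ) (hi : i < n) : a (c i) = c (a i) := by
    rcases lt_or_ge i 6 with h6 | h6
    · interval_cases i <;> rcases c_one with h | h <;> simp [a_small, c_small, h]
    · rw [a_eq i h6, a_eq _ (c_le i h6)]
  refine exists_isStringCGroupRep_of_involutions n a b c ha_inv hb_inv hc_inv
    (mod_four_eq_card_fixed_of_support (s := {0, 1, 4, 5}) (fun i => ?_) (by simp))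
    ?_ ?_ hac ⟨2, by omega, by simp [c_small]⟩
    (x := 0) (y := 1) (z := 2) (by omega) (by omega) (by omega) (by simp) (by simp) (by simp)
    (by simp [a_small, b_small]) (by simp [a_small, b_small]) (by simp [a_small, b_small])
    (fun i hi h0 h1 h2 => ?_) (fun R hR h h01 => ?_) (fun g hg inj hab hbc hr => ?_)
  · simp only [Finset.mem_insert, Finset.mem_singleton, ha]
    split_ifs <;> omega
  · rcases hmod with h | h
    · refine mod_four_eq_card_fixed (s := {0}) (fun i => ?_) (by simpa)
      rw [Finset.mem_singleton, hb]
      split_ifs <;> omega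
    · refine mod_four_eq_card_fixed (s := {0, n - 1}) (fun i => ?_)
        (by rw [Finset.card_pair (by omega), h])
      rw [Finset.mem_insert, Finset.mem_singleton, hb]
      split_ifs <;> omega
  · rcases hmod with h | h
    · refine mod_four_eq_card_fixed (s := {n - 1}) (fun i => ?_) (by simpa)
      rw [Finset.mem_singleton, hc]
      split_ifs <;> omega
    · refine mod_four_eq_card_fixed (s := {0, 1}) (fun i => ?_) (by simpa)
      rw [Finset.mem_insert, Finset.mem_singleton, hc]
      split_ifs <;> omega
  · rcases lt_or_ge i 7 with h7 | h7
    · interval_cases i <;> first | contradiction | simp [a_small, b_small]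
    · simp only [Function.iterate_succ_apply, Function.iterate_zero_apply]
      have h8 : a (b i) = b i := a_eq _ (le_of_lt (b_le i h7))
      have h9 : a (b (b i)) = i := by rw [(hb_inv i hi).2, a_eq i (by omega)]
      rw [h8, h9, h8, h9]
  · have h02 : R 0 2 := by simpa [b_small] using (h 0 (by omega) 1 (by omega) h01).2.1
    have h12 := hR.trans (hR.symm h01) h02
    have h13 := (h 1 (by omega) 2 (by omega) h12).2.2
    have h03 : R 0 3 := by
      rw [c_small.1] at h13
      rcases c_one with ⟨_, h⟩ | ⟨_, h⟩ <;> rw [h] at h13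
      exacts [h13, hR.trans h01 h13]
    refine rel_of_le_of_step (m := 3) hR (fun p hp q hq hpq => (h p hp q hq hpq).2)
      (fun p hp => ?_) (fun p hp hpn => ⟨p - 1, by omega, p - 2, by omega, ?_⟩)
    · interval_cases p
      exacts [hR.refl 0, h01, h02, h03]
    · rcases Nat.mod_two_eq_zero_or_one p with h | h
      · rw [b_odd (p - 1) (by omega) (by omega), b_even (p - 2) (by omega)]
        omega
      · rw [c_odd (p - 2) (by omega) (by omega), c_even (p - 1) (by omega) (by omega) (by omega)]
        omega
  · have hS := hab (· < 3) fun i _ hi => by interval_cases i <;> simp [a_small, b_small]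
    have s0 := hS 0 (by omega) (by omega)
    have s1 := hS 1 (by omega) (by omega)
    have s2 := hS 2 (by omega) (by omega)
    have hfix : g 0 = 0 ∧ g 1 = 1 ∧ g 2 = 2 := by
      have i01 := inj 0 (by omega) 1 (by omega)
      have i12 := inj 1 (by omega) 2 (by omega)
      have r0 := hr 0 (by omega)
      have r1 := hr 1 (by omega)
      rcases c_one with h | h
      · simp only [h, b_small] at r0 r1
        obtain h0 | h0 | h0 : g 0 = 0 ∨ g 0 = 1 ∨ g 0 = 2 := by omega
        all_goals simp only [h0, h, b_small, c_small] at r0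
        · omega
        · have h1 : g 1 = 2 := by omega
          simp [h0, h1, c_small, b_small] at r1
        · omega
      · have h0 : g 0 = 0 := hbc (· = 0) (fun i _ hi => by simp [hi, h, b_small]) 0 (by omega) rfl
        simp only [h, b_small] at r1
        obtain h1 | h1 : g 1 = 1 ∨ g 1 = 2 := by omega
        all_goals simp only [h1, h, b_small, c_small] at r1
        · exact ⟨h0, h1, r1⟩
        · omega
    refine eq_of_le_of_step (m := 2) hb_inv hc_inv hg hr (fun i hi => ?_) fun j hj hjn =>
      ⟨j - 2, by omega, ?_⟩
    · interval_cases i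
      exacts [hfix.1, hfix.2.1, hfix.2.2]
    · rcases Nat.mod_two_eq_zero_or_one j with h | h
      · left
        rw [c_even (j - 2) (by omega) (by omega) (by omega),
          b_odd (j - 2 + 1) (by omega) (by omega)]
        omega
      · right
        rw [c_odd j (by omega) (by omega), b_even _ (by omega)]
        omega

/-- The involutions are `(0 1)(2 4)(3 5)(8 9)`, `(1 2)(5 6)(7 8)⋯` and `(2 3)(4 5)⋯`, the last one
multiplied by `(0 1)` if `n % 4 = 0`. -/
theorem exists_isStringCGroupRep_of_mod_four_eq_zero_or_three {n : ℕ} (hn : 11 ≤ n)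
    (hmod : n % 4 = 0 ∨ n % 4 = 3) :
    ∃ ρ : Fin 3 → alternatingGroup (Fin n), IsStringCGroupRep ρ := by
  obtain ⟨a, ha⟩ : ∃ a : ℕ → ℕ, ∀ i, a i = if i = 0 then 1 else if i = 1 then 0 else
      if i = 2 then 4 else if i = 4 then 2 else if i = 3 then 5 else if i = 5 then 3 else
      if i = 8 then 9 else if i = 9 then 8 else i := ⟨_, fun _ => rfl⟩
  obtain ⟨b, hb⟩ : ∃ b : ℕ → ℕ, ∀ i, b i = if i = 3 ∨ i = 4 then i else
      if i % 2 = 1 then (if i + 1 < n then i + 1 else i) else i - 1 := ⟨_, fun _ => rfl⟩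
  obtain ⟨c, hc⟩ : ∃ c : ℕ → ℕ, ∀ i, c i = if i < 2 ∧ n % 4 = 3 then i else
      if i % 2 = 0 then (if i + 1 < n then i + 1 else i) else i - 1 := ⟨_, fun _ => rfl⟩
  have a_small : a 0 = 1 ∧ a 1 = 0 ∧ a 2 = 4 ∧ a 3 = 5 ∧ a 4 = 2 ∧ a 5 = 3 ∧ a 6 = 6 ∧
      a 7 = 7 ∧ a 8 = 9 ∧ a 9 = 8 ∧ a 10 = 10 := by
    simp [ha]
  have b_small : b 0 = 0 ∧ b 1 = 2 ∧ b 2 = 1 ∧ b 3 = 3 ∧ b 4 = 4 ∧ b 5 = 6 ∧ b 6 = 5 ∧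
      b 7 = 8 ∧ b 8 = 7 ∧ b 9 = 10 ∧ b 10 = 9 := by
    simp [hb]
    omega
  have c_small : c 2 = 3 ∧ c 3 = 2 ∧ c 4 = 5 ∧ c 5 = 4 ∧ c 6 = 7 ∧ c 7 = 6 ∧ c 8 = 9 ∧
      c 9 = 8 := by
    simp [hc]
    omega
  have c_one : c 0 = 1 ∧ c 1 = 0 ∨ c 0 = 0 ∧ c 1 = 1 := by
    rcases hmod with h | h <;> simp [hc, h]
    omega
  have a_eq (i : ℕ) (h : 10 ≤ i) : a i = i := by
    rw [ha]
    split_ifs <;> omega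
  have b_odd (i : ℕ) (h : i % 2 = 1) (h5 : i < 3 ∨ 5 ≤ i) (hi : i + 1 < n) :
      b i = i + 1 := by
    rw [hb, if_neg (by omega), if_pos h, if_pos hi]
  have b_even (i : ℕ) (h : i % 2 = 0) (h5 : i < 3 ∨ 5 ≤ i) : b i = i - 1 := by
    rw [hb, if_neg (by omega), if_neg (by omega)]
  have c_odd (i : ℕ) (h : i % 2 = 1) (hi : 2 ≤ i) : c i = i - 1 := by
    rw [hc, if_neg (by omega), if_neg (by omega)]
  have c_even (i : ℕ) (h : i % 2 = 0) (h2 : 2 ≤ i) (hi : i + 1 < n) : c i = i + 1 := by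
    rw [hc, if_neg (by omega), if_pos h, if_pos hi]
  have ha_inv : ∀ i < n, a i < n ∧ a (a i) = i := fun i hi => by
    rcases lt_or_ge i 10 with h10 | h10
    · interval_cases i <;> simp [a_small] <;> omega
    · rw [a_eq i h10, a_eq i h10]
      exact ⟨hi, rfl⟩
  have hb_inv : ∀ i < n, b i < n ∧ b (b i) = i := fun i hi => by
    rcases lt_or_ge i 6 with h6 | h6
    · interval_cases i <;> simp [b_small] <;> omega
    rcases Nat.mod_two_eq_zero_or_one i with h | h
    · rw [b_even i h (by omega), b_odd (i - 1) (by omega) (by omega) (by omega)]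
      omega
    · rcases lt_or_ge (i + 1) n with hin | hin
      · rw [b_odd i h (by omega) hin, b_even (i + 1) (by omega) (by omega)]
        omega
      · have : b i = i := by rw [hb, if_neg (by omega), if_pos h, if_neg (by omega)]
        rw [this, this]
        exact ⟨hi, rfl⟩
  have hc_inv : ∀ i < n, c i < n ∧ c (c i) = i := fun i hi => by
    rcases lt_or_ge i 2 with h2 | h2
    · interval_cases i <;> rcases c_one with h | h <;> simp [h] <;> omega
    rcases Nat.mod_two_eq_zero_or_one i with h | h
    · rcases lt_or_ge (i + 1) n with hin | hin
      · rw [c_even i h h2 hin, c_odd (i + 1) (by omega) (by omega)]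
        omega
      · have : c i = i := by rw [hc, if_neg (by omega), if_pos h, if_neg (by omega)]
        rw [this, this]
        exact ⟨hi, rfl⟩
    · rw [c_odd i h h2]
      rcases lt_or_ge (i - 1) 2 with h3 | h3
      · omega
      · rw [c_even (i - 1) (by omega) h3 (by omega)]
        omega
  have b_le (i : ℕ) (h : 11 ≤ i) : 11 ≤ b i := by
    rw [hb]
    split_ifs <;> omega
  have c_le (i : ℕ) (h : 10 ≤ i) : 10 ≤ c i := by
    rw [hc]
    split_ifs <;> omega
  have hac (i : ℕ) (hi : i < n) : a (c i) = c (a i) := by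
    rcases lt_or_ge i 10 with h10 | h10
    · interval_cases i <;> rcases c_one with h | h <;> simp [a_small, c_small, h]
    · rw [a_eq i h10, a_eq _ (c_le i h10)]
  refine exists_isStringCGroupRep_of_involutions n a b c ha_inv hb_inv hc_inv
    (mod_four_eq_card_fixed_of_support (s := {0, 1, 2, 3, 4, 5, 8, 9}) (fun i => ?_) (by simp))
    ?_ ?_ hac ⟨2, by omega, by simp [c_small]⟩
    (x := 3) (y := 5) (z := 6) (by omega) (by omega) (by omega) (by simp) (by simp) (by simp)
    (by simp [a_small, b_small]) (by simp [a_small, b_small]) (by simp [a_small, b_small])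
    (fun i hi h3 h5 h6 => ?_) (fun R hR h h35 => ?_) (fun g hg inj hab hbc hr => ?_)
  · simp only [Finset.mem_insert, Finset.mem_singleton, ha]
    split_ifs <;> omega
  · rcases hmod with h | h
    · refine mod_four_eq_card_fixed (s := {0, 3, 4, n - 1}) (fun i => ?_) ?_
      · simp only [Finset.mem_insert, Finset.mem_singleton, hb]
        split_ifs <;> omega
      · rw [Finset.card_insert_of_notMem, Finset.card_insert_of_notMem, Finset.card_pair, h]
        all_goals
          try simp only [Finset.mem_insert, Finset.mem_singleton]
          omega
    · refine mod_four_eq_card_fixed (s := {0, 3, 4}) (fun i => ?_) (by simpa)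
      simp only [Finset.mem_insert, Finset.mem_singleton, hb]
      split_ifs <;> omega
  · rcases hmod with h | h
    · refine mod_four_eq_card_fixed (s := ∅) (fun i => ?_) (by simpa)
      simp only [Finset.notMem_empty, false_iff, hc]
      split_ifs <;> omega
    · refine mod_four_eq_card_fixed (s := {0, 1, n - 1}) (fun i => ?_) ?_
      · simp only [Finset.mem_insert, Finset.mem_singleton, hc]
        split_ifs <;> omega
      · rw [Finset.card_insert_of_notMem, Finset.card_pair, h]
        all_goals
          try simp only [Finset.mem_insert, Finset.mem_singleton]
          omega
  · rcases lt_or_ge i 11 with h11 | h11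
    · interval_cases i <;> first | contradiction | simp [a_small, b_small]
    · simp only [Function.iterate_succ_apply, Function.iterate_zero_apply]
      have h8 : a (b i) = b i := a_eq _ (le_of_lt (b_le i h11))
      have h9 : a (b (b i)) = i := by rw [(hb_inv i hi).2, a_eq i (by omega)]
      rw [h8, h9, h8, h9]
  · have h36 : R 3 6 := by
      simpa [b_small] using (h 3 (by omega) 5 (by omega) h35).2.1
    have h24 : R 2 4 := by
      simpa [c_small] using (h 3 (by omega) 5 (by omega) h35).2.2
    have h27 : R 2 7 := by
      simpa [c_small] using (h 3 (by omega) 6 (by omega) h36).2.2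
    have h14 : R 1 4 := by
      simpa [b_small] using (h 2 (by omega) 4 (by omega) h24).2.1
    have h18 : R 1 8 := by
      simpa [b_small] using (h 2 (by omega) 7 (by omega) h27).2.1
    have h02 : R 0 2 := by
      simpa [a_small] using (h 1 (by omega) 4 (by omega) h14).1
    have h09 : R 0 9 := by
      simpa [a_small] using (h 1 (by omega) 8 (by omega) h18).1
    have h010 : R 0 10 := by
      simpa [b_small] using (h 0 (by omega) 9 (by omega) h09).2.1
    have h78 : R 7 8 :=
      hR.trans (hR.symm h27) (hR.trans h24 (hR.trans (hR.symm h14) h18))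
    have h69 : R 6 9 := by
      simpa [c_small] using (h 7 (by omega) 8 (by omega) h78).2.2
    have h39 := hR.trans h36 h69
    have h30 := hR.trans h39 (hR.symm h09)
    have h32 := hR.trans h30 h02
    have h34 := hR.trans h32 h24
    have h31 := hR.trans h34 (hR.symm h14)
    have h37 := hR.trans h32 h27
    have h38 := hR.trans h31 h18
    have h310 := hR.trans h30 h010
    refine rel_of_le_of_step (m := 10) hR (fun p hp q hq hpq => (h p hp q hq hpq).2)
      (fun p hp => ?_) (fun p hp hpn => ⟨p - 1, by omega, p - 2, by omega, ?_⟩)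
    · interval_cases p
      exacts [h30, h31, h32, hR.refl 3, h34, h35, h36, h37, h38, h39, h310]
    · rcases Nat.mod_two_eq_zero_or_one p with h | h
      · rw [b_odd (p - 1) (by omega) (by omega) (by omega), b_even (p - 2) (by omega) (by omega)]
        omega
      · rw [c_odd (p - 2) (by omega) (by omega), c_even (p - 1) (by omega) (by omega) (by omega)]
        omega
  · have hS := hab (fun i => i < 3 ∨ i = 4) fun i _ hi => by
      obtain rfl | rfl | rfl | rfl : i = 0 ∨ i = 1 ∨ i = 2 ∨ i = 4 := by omega
      all_goals simp [a_small, b_small]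
    have hT := hab (fun i => i = 3 ∨ i = 5 ∨ i = 6) fun i _ hi => by
      obtain rfl | rfl | rfl := hi
      all_goals simp [a_small, b_small]
    have hU := hbc (· < 4) fun i _ hi => by
      interval_cases i <;> rcases c_one with h | h <;> simp [h, b_small, c_small]
    have hV := hbc (4 ≤ ·) fun i hi h4 => by
      simp only [hb, hc]
      split_ifs <;> omega
    have g3 : g 3 = 3 := by
      have := hT 3 (by omega) (by omega)
      have := hU 3 (by omega) (by omega)
      omega
    have g4 : g 4 = 4 := by
      have := hS 4 (by omega) (by omega)
      have := hV 4 (by omega) (by omega)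
      omega
    have g5 : g 5 = 5 := by
      have r5 := hr 5 (by omega)
      simp only [c_small, b_small, g4] at r5
      have h5 := hT 5 (by omega) (by omega)
      obtain h5 | h5 | h5 := h5
      all_goals simp only [h5, b_small, c_small] at r5
      all_goals omega
    have g1 : g 1 = 1 := by simpa [c_small, b_small, g3] using hr 3 (by omega)
    have hfix : g 0 = 0 ∧ g 2 = 2 := by
      have r0 := hr 0 (by omega)
      have r1 := hr 1 (by omega)
      rcases c_one with h | h
      · simp only [h, b_small, g1] at r0 r1
        simp only [r1, h, b_small] at r0
        exact ⟨r1, r0⟩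
      · simp only [h, b_small, g1] at r1
        have := hS 0 (by omega) (by omega)
        have := inj 0 (by omega) 1 (by omega)
        have := inj 0 (by omega) 2 (by omega)
        have := inj 0 (by omega) 4 (by omega)
        omega
    refine eq_of_le_of_step (m := 5) hb_inv hc_inv hg hr (fun i hi => ?_) fun j hj hjn =>
      ⟨j - 2, by omega, ?_⟩
    · interval_cases i
      exacts [hfix.1, g1, hfix.2, g3, g4, g5]
    · rcases Nat.mod_two_eq_zero_or_one j with h | h
      · left
        rw [c_even (j - 2) (by omega) (by omega) (by omega), b_odd (j - 2 + 1) (by omega) (by omega)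
          (by omega)]
        omega
      · right
        rw [c_odd j (by omega) (by omega), b_even _ (by omega) (by omega)]
        omega

/-- Every alternating group `A_n` with `n = 5` or `n ≥ 9` has a string C-group
representation of rank three. -/
theorem alternatingGroup_exists_rank_three (n : ℕ) (hn : n = 5 ∨ 9 ≤ n) :
    ∃ ρ : Fin 3 → alternatingGroup (Fin n), IsStringCGroupRep ρ := by
  obtain rfl | hn := hn
  · exact exists_isStringCGroupRep_five
  · obtain h | h : (n % 4 = 1 ∨ n % 4 = 2) ∨ n % 4 = 0 ∨ n % 4 = 3 := by omega
    · exact exists_isStringCGroupRep_of_mod_four_eq_one_or_two hn h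
    · exact exists_isStringCGroupRep_of_mod_four_eq_zero_or_three (by omega) h
end
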